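/- Let p > 0 and let a = (a_n)_n ∈ S_p be a strictly decreasing sequence with decreasing gaps. Then the box-counting dimension of E_a exists and equals 1/(p + 1). -/

import Mathlib

open Filter Topology
open scoped ENNReal

/-- `coveringNumber r F` is the smallest number of sets of diameter at most `r`
needed to cover `F` (the box-counting function `N_r(F)`). -/
noncomputable def coveringNumber (r : ℝ) (F : Set ℝ) : ℕ :=
  sInf {n : ℕ | ∃ 𝒰 : Finset (Set ℝ), 𝒰.card = n ∧ (F ⊆ ⋃ U ∈ 𝒰, U) ∧
    ∀ U ∈ 𝒰, EMetric.diam U ≤ ENNReal.ofReal r}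

/-- The lower box-counting dimension `liminf_{r → 0⁺} log N_r(F) / (-log r)`. -/
noncomputable def lowerBoxDim (F : Set ℝ) : ℝ :=
  liminf (fun r : ℝ => Real.log (coveringNumber r F) / (-Real.log r)) (𝓝[>] 0)

/-- The upper box-counting dimension `limsup_{r → 0⁺} log N_r(F) / (-log r)`. -/
noncomputable def upperBoxDim (F : Set ℝ) : ℝ :=
  limsup (fun r : ℝ => Real.log (coveringNumber r F) / (-Real.log r)) (𝓝[>] 0)

/-- A finite cover of `F` by sets of diameter at most `r` bounds `coveringNumber r F`. -/
lemma coveringNumber_le_card {r : ℝ} {F : Set ℝ} (𝒰 : Finset (Set ℝ)) (hF : F ⊆ ⋃ U ∈ 𝒰, U)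
    (hd : ∀ U ∈ 𝒰, Metric.ediam U ≤ ENNReal.ofReal r) : coveringNumber r F ≤ 𝒰.card :=
  Nat.sInf_le ⟨𝒰, rfl, hF, hd⟩

/-- The range of an antitone nonnegative sequence, together with `0`, is covered by the first `M`
singletons and by consecutive intervals of length `r` covering `[0, a M]`. -/
lemma exists_cover_range {a : ℕ → ℝ} (hnonneg : ∀ n, 0 ≤ a n) (ha : Antitone a) {r : ℝ}
    (hr : 0 < r) (M : ℕ) :
    ∃ 𝒰 : Finset (Set ℝ), 𝒰.card ≤ M + (⌊a M / r⌋₊ + 1) ∧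
      (Set.range a ∪ {0} ⊆ ⋃ U ∈ 𝒰, U) ∧ ∀ U ∈ 𝒰, Metric.ediam U ≤ ENNReal.ofReal r := by
  classical
  have small : ∀ x, 0 ≤ x → x ≤ a M →
      ∃ j < ⌊a M / r⌋₊ + 1, x ∈ Set.Icc ((j : ℝ) * r) ((j : ℝ) * r + r) := by
    intro x hx hxM
    refine ⟨⌊x / r⌋₊, Nat.lt_succ_of_le (Nat.floor_mono (by gcongr)), ?_, ?_⟩
    · exact (le_div_iff₀ hr).1 (Nat.floor_le (by positivity))
    · have := (div_lt_iff₀ hr).1 (Nat.lt_floor_add_one (x / r))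
      linarith
  refine ⟨(Finset.range M).image (fun n => {a n}) ∪
    (Finset.range (⌊a M / r⌋₊ + 1)).image
      (fun j : ℕ => Set.Icc ((j : ℝ) * r) ((j : ℝ) * r + r)), ?_, ?_, ?_⟩
  · refine (Finset.card_union_le _ _).trans (add_le_add ?_ ?_)
    · exact Finset.card_image_le.trans (by simp)
    · exact Finset.card_image_le.trans (by simp)
  · intro x hx
    have hcases : (∃ n < M, x = a n) ∨ (0 ≤ x ∧ x ≤ a M) := by
      rcases hx with ⟨n, rfl⟩ | hx
      · rcases lt_or_ge n M with h | h
        · exact Or.inl ⟨n, h, rfl⟩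
        · exact Or.inr ⟨hnonneg n, ha h⟩
      · rw [Set.mem_singleton_iff.1 hx]
        exact Or.inr ⟨le_rfl, hnonneg M⟩
    rw [Set.mem_iUnion₂]
    rcases hcases with ⟨n, hn, rfl⟩ | ⟨h0, h1⟩
    · exact ⟨{a n}, Finset.mem_union_left _
        (Finset.mem_image_of_mem _ (Finset.mem_range.2 hn)), rfl⟩
    · obtain ⟨j, hj, hxj⟩ := small x h0 h1
      exact ⟨_, Finset.mem_union_right _
        (Finset.mem_image_of_mem _ (Finset.mem_range.2 hj)), hxj⟩
  · intro U hU
    rcases Finset.mem_union.1 hU with h | h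
    · obtain ⟨n, -, rfl⟩ := Finset.mem_image.1 h
      exact Metric.ediam_singleton.trans_le zero_le
    · obtain ⟨j, -, rfl⟩ := Finset.mem_image.1 h
      exact (Real.ediam_Icc _ _).trans_le (by simp)

lemma coveringNumber_range_le {a : ℕ → ℝ} (hnonneg : ∀ n, 0 ≤ a n) (ha : Antitone a) {r : ℝ}
    (hr : 0 < r) (M : ℕ) :
    (coveringNumber r (Set.range a ∪ {0}) : ℝ) ≤ M + a M / r + 1 := by
  obtain ⟨𝒰, hcard, hcov, hd⟩ := exists_cover_range hnonneg ha hr M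
  have h : (coveringNumber r (Set.range a ∪ {0}) : ℝ) ≤ M + (⌊a M / r⌋₊ + 1) := by
    exact_mod_cast (coveringNumber_le_card 𝒰 hcov hd).trans hcard
  have := Nat.floor_le (div_nonneg (hnonneg M) hr.le)
  linarith

/-- If the first `K` terms of the sequence are more than `r` apart, then at least `K` sets of
diameter at most `r` are needed. -/
lemma le_coveringNumber_range {a : ℕ → ℝ} (hnonneg : ∀ n, 0 ≤ a n) (ha : Antitone a) {r : ℝ}
    (hr : 0 < r) {K : ℕ} (hsep : ∀ i j, i < j → j < K → r < a i - a j) :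
    K ≤ coveringNumber r (Set.range a ∪ {0}) := by
  obtain ⟨𝒱, -, hcov, hd⟩ := exists_cover_range hnonneg ha hr 0
  refine le_csInf ⟨𝒱.card, 𝒱, rfl, hcov, hd⟩ ?_
  rintro _ ⟨𝒰, rfl, hcov, hd⟩
  have hmem : ∀ n, ∃ U ∈ 𝒰, a n ∈ U := by
    intro n
    simpa using hcov (Or.inl ⟨n, rfl⟩)
  choose U hU haU using hmem
  have hne : ∀ i j, i < j → j < K → U i ≠ U j := by
    intro i j hij hj h
    have h1 : edist (a i) (a j) ≤ ENNReal.ofReal r :=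
      (Metric.edist_le_ediam_of_mem (haU i) (h ▸ haU j)).trans (hd _ (hU i))
    rw [edist_dist, ENNReal.ofReal_le_ofReal_iff hr.le, Real.dist_eq] at h1
    exact absurd ((le_abs_self _).trans h1) (not_le.2 (hsep i j hij hj))
  have := Finset.card_le_card_of_injOn (s := Finset.range K) (t := 𝒰) U (fun i _ => hU i) (by
    intro i hi j hj h
    simp only [Finset.coe_range, Set.mem_Iio] at hi hj
    rcases lt_trichotomy i j with hij | hij | hij
    · exact absurd h (hne i j hij hj)
    · exact hij
    · exact absurd h.symm (hne j i hij hi))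
  simpa using this

lemma antitone_gap {a : ℕ → ℝ} (hgaps : ∀ n, a (n + 1) - a (n + 2) ≤ a n - a (n + 1)) :
    Antitone fun n => a n - a (n + 1) :=
  antitone_nat_of_succ_le hgaps

lemma sub_le_mul_gap {a : ℕ → ℝ} (hgaps : ∀ n, a (n + 1) - a (n + 2) ≤ a n - a (n + 1))
    (n k : ℕ) : a n - a (n + k) ≤ k * (a n - a (n + 1)) := by
  induction k with
  | zero => simp
  | succ k ih =>
    have h : a (n + k) - a (n + k + 1) ≤ a n - a (n + 1) :=
      antitone_gap hgaps (Nat.le_add_right n k)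
    push_cast
    rw [← add_assoc]
    linarith

lemma eventually_le_rpow_neg {p q : ℝ} (hq : q < p) {a : ℕ → ℝ} (hapos : ∀ n, 0 < a n)
    (haSp : Tendsto (fun n : ℕ => (-Real.log (a n)) / Real.log n) atTop (𝓝 p)) :
    ∀ᶠ n : ℕ in atTop, a n ≤ (n : ℝ) ^ (-q) := by
  filter_upwards [haSp.eventually (lt_mem_nhds hq), eventually_ge_atTop 2] with n hn h2
  have h2' : (1 : ℝ) < n := by exact_mod_cast h2
  have hn' := (lt_div_iff₀ (Real.log_pos h2')).1 hn
  rw [← Real.log_le_log_iff (hapos n) (by positivity), Real.log_rpow (by linarith)]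
  linarith

lemma eventually_rpow_neg_le {p q : ℝ} (hq : p < q) {a : ℕ → ℝ} (hapos : ∀ n, 0 < a n)
    (haSp : Tendsto (fun n : ℕ => (-Real.log (a n)) / Real.log n) atTop (𝓝 p)) :
    ∀ᶠ n : ℕ in atTop, (n : ℝ) ^ (-q) ≤ a n := by
  filter_upwards [haSp.eventually (gt_mem_nhds hq), eventually_ge_atTop 2] with n hn h2
  have h2' : (1 : ℝ) < n := by exact_mod_cast h2
  have hn' := (div_lt_iff₀ (Real.log_pos h2')).1 hn
  rw [← Real.log_le_log_iff (by positivity) (hapos n), Real.log_rpow (by linarith)]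
  linarith

lemma eventually_rpow_neg_add_le {A B C : ℝ} (hB : A < B) (hC : A < C) :
    ∀ᶠ n : ℕ in atTop, (n : ℝ) ^ (-B) + (n : ℝ) ^ (-C) ≤ (n : ℝ) ^ (-A) := by
  have lim : ∀ D, A < D → Tendsto (fun n : ℕ => (n : ℝ) ^ (-(D - A))) atTop (𝓝 0) := fun D hD =>
    (tendsto_rpow_neg_atTop (sub_pos.2 hD)).comp tendsto_natCast_atTop_atTop
  have h := (lim B hB).add (lim C hC)
  rw [add_zero] at h
  filter_upwards [h.eventually (gt_mem_nhds one_pos), eventually_gt_atTop 0] with n hn h0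
  have h0' : (0 : ℝ) < n := by exact_mod_cast h0
  have e : ∀ D, (n : ℝ) ^ (-D) = (n : ℝ) ^ (-(D - A)) * (n : ℝ) ^ (-A) := fun D => by
    rw [← Real.rpow_add h0']; ring_nf
  rw [e B, e C, ← add_mul]
  exact mul_le_of_le_one_left (by positivity) hn.le

/-- Gaps of a sequence in `S_p` with decreasing gaps decay no faster than `n ^ (-q)`, for every
`q > p + 1`. -/
lemma eventually_rpow_neg_le_gap {p q : ℝ} (hp : 0 < p) (hq : p + 1 < q) {a : ℕ → ℝ}
    (hapos : ∀ n, 0 < a n)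
    (haSp : Tendsto (fun n : ℕ => (-Real.log (a n)) / Real.log n) atTop (𝓝 p))
    (hgaps : ∀ n, a (n + 1) - a (n + 2) ≤ a n - a (n + 1)) :
    ∀ᶠ n : ℕ in atTop, (n : ℝ) ^ (-q) ≤ a n - a (n + 1) := by
  obtain ⟨s, hs1, hsq⟩ : ∃ s, 1 < s ∧ s < q - p := exists_between (by linarith)
  obtain ⟨u, hpu, hu⟩ : ∃ u, p < u ∧ u < min (q - s) (p * s) :=
    exists_between (lt_min (by linarith) (by nlinarith))
  have hu1 := hu.trans_le (min_le_left _ _)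
  have hu2 := hu.trans_le (min_le_right _ _)
  obtain ⟨v, hv, hvp⟩ : ∃ v, u / s < v ∧ v < p :=
    exists_between ((div_lt_iff₀ (by linarith)).2 hu2)
  have hv0 : 0 < v := lt_trans (div_pos (by linarith) (by linarith)) hv
  have huv : u < s * v := by rwa [div_lt_iff₀' (by linarith)] at hv
  have hceil : Tendsto (fun n : ℕ => ⌈(n : ℝ) ^ s⌉₊) atTop atTop :=
    tendsto_nat_ceil_atTop.comp
      ((tendsto_rpow_atTop (by linarith)).comp tendsto_natCast_atTop_atTop)
  filter_upwards [eventually_rpow_neg_le hpu hapos haSp,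
    hceil.eventually (eventually_le_rpow_neg hvp hapos haSp),
    eventually_rpow_neg_add_le (A := u + s) (B := s * v + s) (C := q) (by linarith) (by linarith),
    eventually_ge_atTop 1] with n h1 h2 h3 h4
  have hn1 : (1 : ℝ) ≤ n := by exact_mod_cast h4
  have hn0 : (0 : ℝ) < n := by linarith
  have hns : (n : ℝ) ≤ (n : ℝ) ^ s := Real.self_le_rpow_of_one_le hn1 hs1.le
  have hK : n ≤ ⌈(n : ℝ) ^ s⌉₊ := by exact_mod_cast hns.trans (Nat.le_ceil _)
  obtain ⟨k, hk⟩ := Nat.exists_eq_add_of_le hK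
  have hk' : (k : ℝ) ≤ (n : ℝ) ^ s := by
    have hlt := Nat.ceil_lt_add_one (a := (n : ℝ) ^ s) (by positivity)
    rw [hk] at hlt
    push_cast at hlt
    linarith
  have h5 : a ⌈(n : ℝ) ^ s⌉₊ ≤ (n : ℝ) ^ (-(s * v)) := by
    refine h2.trans ?_
    rw [← mul_neg, Real.rpow_mul hn0.le]
    exact Real.rpow_le_rpow_of_nonpos (by positivity) (Nat.le_ceil _) (by linarith)
  have h6 := sub_le_mul_gap hgaps n k
  rw [← hk] at h6
  have hP : 0 < (n : ℝ) ^ s := by positivity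
  have h7 : (n : ℝ) ^ (-q) * (n : ℝ) ^ s ≤ (n : ℝ) ^ (-u) - (n : ℝ) ^ (-(s * v)) := by
    have e : ∀ D, (n : ℝ) ^ (-(D + s)) * (n : ℝ) ^ s = (n : ℝ) ^ (-D) := fun D => by
      rw [← Real.rpow_add hn0]; ring_nf
    rw [← e u, ← e (s * v), ← sub_mul]
    exact mul_le_mul_of_nonneg_right (by linarith) hP.le
  have h8 : (n : ℝ) ^ (-q) * (n : ℝ) ^ s ≤ k * (a n - a (n + 1)) := by linarith
  have hg : 0 ≤ a n - a (n + 1) := by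
    by_contra! hneg
    have : (0 : ℝ) < (n : ℝ) ^ (-q) * (n : ℝ) ^ s := by positivity
    have : (k : ℝ) * (a n - a (n + 1)) ≤ 0 := mul_nonpos_of_nonneg_of_nonpos (by positivity) hneg.le
    linarith
  have h9 : (k : ℝ) * (a n - a (n + 1)) ≤ (a n - a (n + 1)) * (n : ℝ) ^ s := by
    rw [mul_comm]; exact mul_le_mul_of_nonneg_left hk' hg
  exact le_of_mul_le_mul_right (h8.trans h9) hP

lemma tendsto_rpow_nhdsGT_zero {c : ℝ} (hc : 0 < c) :
    Tendsto (fun r : ℝ => r ^ c) (𝓝[>] 0) (𝓝 0) := by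
  have h := (Real.continuousAt_rpow_const 0 c (Or.inr hc.le)).tendsto
  rw [Real.zero_rpow hc.ne'] at h
  exact h.mono_left nhdsWithin_le_nhds

lemma eventually_coveringNumber_lt {p c : ℝ} (hp : 0 < p) (hc : 1 / (p + 1) < c) {a : ℕ → ℝ}
    (hapos : ∀ n, 0 < a n) (ha : Antitone a)
    (haSp : Tendsto (fun n : ℕ => (-Real.log (a n)) / Real.log n) atTop (𝓝 p)) :
    ∀ᶠ r : ℝ in 𝓝[>] 0, (coveringNumber r (Set.range a ∪ {0}) : ℝ) < r ^ (-c) := by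
  set t := 1 / (p + 1) with ht
  have ht0 : 0 < t := by positivity
  have htp : t * (p + 1) = 1 := by rw [ht]; field_simp
  obtain ⟨q, hq, hqp⟩ : ∃ q, max 0 ((1 - c) / t) < q ∧ q < p :=
    exists_between (max_lt hp ((div_lt_iff₀ ht0).2 (by nlinarith)))
  have hq0 : 0 < q := (le_max_left _ _).trans_lt hq
  have hq1 : 0 < c + t * q - 1 := by
    have := (le_max_right _ _).trans_lt hq
    rw [div_lt_iff₀' ht0] at this
    linarith
  have hceil : Tendsto (fun r : ℝ => ⌈r ^ (-t)⌉₊) (𝓝[>] 0) atTop :=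
    tendsto_nat_ceil_atTop.comp (tendsto_rpow_neg_nhdsGT_zero (neg_lt_zero.2 ht0))
  have lim := ((tendsto_rpow_nhdsGT_zero (sub_pos.2 hc)).add
    ((tendsto_rpow_nhdsGT_zero (ht0.trans hc)).const_mul 2)).add (tendsto_rpow_nhdsGT_zero hq1)
  simp only [mul_zero, add_zero] at lim
  filter_upwards [hceil.eventually (eventually_le_rpow_neg hqp hapos haSp),
    lim.eventually (gt_mem_nhds one_pos), self_mem_nhdsWithin] with r h1 h2 hr
  have hr : (0 : ℝ) < r := hr
  have h3 := coveringNumber_range_le (fun n => (hapos n).le) ha hr ⌈r ^ (-t)⌉₊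
  have h4 := Nat.ceil_lt_add_one (a := r ^ (-t)) (by positivity)
  have h5 : a ⌈r ^ (-t)⌉₊ / r ≤ r ^ (t * q - 1) := by
    rw [Real.rpow_sub_one hr.ne']
    gcongr
    refine h1.trans ?_
    rw [show t * q = (-t) * (-q) by ring, Real.rpow_mul hr.le]
    exact Real.rpow_le_rpow_of_nonpos (by positivity) (Nat.le_ceil _) (by linarith)
  have h6 := mul_lt_mul_of_pos_right h2 (Real.rpow_pos_of_pos hr (-c))
  rw [one_mul, add_mul, add_mul, mul_assoc, ← Real.rpow_add hr, ← Real.rpow_add hr,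
    ← Real.rpow_add hr, show c - t + -c = -t by ring, show c + -c = 0 by ring,
    show c + t * q - 1 + -c = t * q - 1 by ring, Real.rpow_zero] at h6
  linarith

lemma eventually_rpow_neg_le_coveringNumber {p q : ℝ} (hp : 0 < p) (hq : p + 1 < q) {a : ℕ → ℝ}
    (hapos : ∀ n, 0 < a n) (ha : Antitone a)
    (haSp : Tendsto (fun n : ℕ => (-Real.log (a n)) / Real.log n) atTop (𝓝 p))
    (hgaps : ∀ n, a (n + 1) - a (n + 2) ≤ a n - a (n + 1)) :
    ∀ᶠ r : ℝ in 𝓝[>] 0, r ^ (-(1 / q)) ≤ coveringNumber r (Set.range a ∪ {0}) := by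
  have hq0 : 0 < q := by linarith
  have hM : Tendsto (fun r : ℝ => ⌈r ^ (-(1 / q))⌉₊ - 1) (𝓝[>] 0) atTop :=
    (tendsto_sub_atTop_nat 1).comp
      (tendsto_nat_ceil_atTop.comp (tendsto_rpow_neg_nhdsGT_zero (neg_lt_zero.2 (by positivity))))
  filter_upwards [hM.eventually (eventually_rpow_neg_le_gap hp hq hapos haSp hgaps),
    hM.eventually (eventually_ge_atTop 1), self_mem_nhdsWithin] with r h1 h2 hr
  have hr : (0 : ℝ) < r := hr
  have h3 : r ^ (-(1 / q)) ≤ ⌈r ^ (-(1 / q))⌉₊ := Nat.le_ceil _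
  have h4 := Nat.ceil_lt_add_one (a := r ^ (-(1 / q))) (by positivity)
  obtain ⟨M, hMeq⟩ : ∃ M, ⌈r ^ (-(1 / q))⌉₊ = M + 1 := ⟨⌈r ^ (-(1 / q))⌉₊ - 1, by omega⟩
  rw [hMeq, Nat.add_sub_cancel] at h1 h2
  rw [hMeq] at h3 h4
  push_cast at h4
  have hM0 : (0 : ℝ) < M := by exact_mod_cast h2
  have hlt : r < a M - a (M + 1) := by
    refine lt_of_lt_of_le ?_ h1
    have h5 : (r ^ (-(1 / q))) ^ (-q) < (M : ℝ) ^ (-q) :=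
      Real.rpow_lt_rpow_of_neg hM0 (by linarith) (by linarith)
    rwa [← Real.rpow_mul hr.le, show -(1 / q) * -q = 1 by field_simp, Real.rpow_one] at h5
  refine h3.trans ?_
  exact_mod_cast le_coveringNumber_range (fun n => (hapos n).le) ha hr (K := M + 1) (by
    intro i j hij hj
    have h6 : a M - a (M + 1) ≤ a i - a (i + 1) := antitone_gap hgaps (by omega)
    have h7 : a j ≤ a (i + 1) := ha hij
    linarith)

lemma tendsto_log_coveringNumber_div {p : ℝ} (hp : 0 < p) {a : ℕ → ℝ}
    (hapos : ∀ n, 0 < a n) (ha : Antitone a)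
    (haSp : Tendsto (fun n : ℕ => (-Real.log (a n)) / Real.log n) atTop (𝓝 p))
    (hgaps : ∀ n, a (n + 1) - a (n + 2) ≤ a n - a (n + 1)) :
    Tendsto (fun r : ℝ => Real.log (coveringNumber r (Set.range a ∪ {0})) / (-Real.log r))
      (𝓝[>] 0) (𝓝 (1 / (p + 1))) := by
  have hlt1 : ∀ᶠ r : ℝ in 𝓝[>] 0, r < 1 := nhdsWithin_le_nhds (gt_mem_nhds one_pos)
  have hpos : ∀ᶠ r : ℝ in 𝓝[>] 0, 0 < coveringNumber r (Set.range a ∪ {0}) := by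
    filter_upwards [self_mem_nhdsWithin] with r hr
    exact le_coveringNumber_range (fun n => (hapos n).le) ha hr (K := 1) (by omega)
  refine tendsto_order.2 ⟨fun c hc => ?_, fun c hc => ?_⟩
  · obtain ⟨d, hd, hdp⟩ : ∃ d, max c 0 < d ∧ d < 1 / (p + 1) :=
      exists_between (max_lt hc (by positivity))
    have hd0 : 0 < d := (le_max_right _ _).trans_lt hd
    have hq : p + 1 < 1 / d := (lt_one_div (by positivity) hd0).2 hdp
    filter_upwards [eventually_rpow_neg_le_coveringNumber hp hq hapos ha haSp hgaps, hlt1,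
      self_mem_nhdsWithin] with r h1 h2 hr
    have hr : (0 : ℝ) < r := hr
    have hlog := Real.log_neg hr h2
    have h3 := Real.log_le_log (by positivity) h1
    rw [one_div_one_div, Real.log_rpow hr] at h3
    refine ((le_max_left _ _).trans_lt hd).trans_le ((le_div_iff₀ (by linarith)).2 (by linarith))
  · filter_upwards [eventually_coveringNumber_lt hp hc hapos ha haSp, hpos, hlt1,
      self_mem_nhdsWithin] with r h1 h0 h2 hr
    have hr : (0 : ℝ) < r := hr
    have hlog := Real.log_neg hr h2
    have h3 := Real.log_lt_log (by exact_mod_cast h0) h1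
    rw [Real.log_rpow hr] at h3
    exact (div_lt_iff₀ (by linarith)).2 (by linarith)

/-- **Corollary 1.10.** If `a ∈ S_p` (`p > 0`) is a strictly decreasing sequence
with decreasing gaps, then the box-counting dimension of `E_a = {a_n} ∪ {0}`
exists and equals `1/(p+1)`. -/
theorem boxDim_of_Sp_sequence
    (p : ℝ) (hp : 0 < p) (a : ℕ → ℝ) (hapos : ∀ n, 0 < a n)
    (haanti : StrictAnti a) (halim : Tendsto a atTop (𝓝 0))
    (haSp : Tendsto (fun n : ℕ => (-Real.log (a n)) / Real.log n) atTop (𝓝 p))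
    (hagaps : ∀ n, a (n + 1) - a (n + 2) ≤ a n - a (n + 1)) :
    lowerBoxDim (Set.range a ∪ {0}) = 1 / (p + 1) ∧
      upperBoxDim (Set.range a ∪ {0}) = 1 / (p + 1) := by
  have h := tendsto_log_coveringNumber_div hp hapos haanti.antitone haSp hagaps
  exact ⟨h.liminf_eq, h.limsup_eq⟩
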